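/- Let f : F_q^k → F_q^k be a bijective linear map, k ≥ b ≥ 1, t ≥ 1, and let P ⊆ F_q^r be a code indexed by F_q^k with d_b(p_i, p_j) ≥ max(2t − b + 2 − d_b(u_i, u_j), 0) for all i ≠ j. Then k + r ≥ (q^b/(q^b − 1))(2t − b + 2)(1 − q^{−k}). -/

import Mathlib

open Finset

/-- The b-symbol read vector of `u`: the length-`k` vector of cyclic windows of length `b`. -/
def piB (F : Type*) (k b : ℕ) (u : Fin k → F) : Fin k → (Fin b → F) :=
  fun i j => u ⟨(i.val + j.val) % k, Nat.mod_lt _ i.pos⟩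

/-- The b-symbol distance between `u` and `v`. -/
def dB (F : Type*) [DecidableEq F] (k b : ℕ) (u v : Fin k → F) : ℕ :=
  hammingDist (piB F k b u) (piB F k b v)

/-- The b-symbol weight of `u`: the number of nonzero cyclic windows of length `b`. -/
def wB (F : Type*) [DecidableEq F] [Zero F] (k b : ℕ) (u : Fin k → F) : ℕ :=
  (Finset.univ.filter (fun i : Fin k => piB F k b u i ≠ 0)).card

lemma pairs_ne_bound {α β : Type*} [Fintype α] [Fintype β] [DecidableEq β] (g : α → β) :
    (Fintype.card β : ℝ) * (∑ u : α, ∑ v : α, (if g u ≠ g v then (1 : ℝ) else 0))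
      ≤ (Fintype.card α : ℝ) ^ 2 * ((Fintype.card β : ℝ) - 1) := by
  have h1 : ∀ u v : α, (if g u ≠ g v then (1 : ℝ) else 0)
      = 1 - ∑ c : β, (if g u = c then (1 : ℝ) else 0) * (if g v = c then (1 : ℝ) else 0) := by
    intro u v
    by_cases h : g u = g v <;> simp [h, eq_comm]
  have h2 : (∑ u : α, ∑ v : α, (if g u ≠ g v then (1 : ℝ) else 0))
      = (Fintype.card α : ℝ) ^ 2 - ∑ c : β, (∑ u : α, (if g u = c then (1 : ℝ) else 0)) ^ 2 := by
    simp_rw [h1, Finset.sum_sub_distrib]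
    congr 1
    · simp [sq]
    · simp_rw [sq, Finset.sum_mul_sum]
      rw [Finset.sum_comm' (t' := Finset.univ) (s' := fun _ => Finset.univ) (by simp)]
      rw [Finset.sum_comm]
      conv_rhs => rw [Finset.sum_comm]
      refine Finset.sum_congr rfl fun u _ => ?_
      rw [Finset.sum_comm]
  have h3 : ∑ c : β, (∑ u : α, (if g u = c then (1 : ℝ) else 0)) = Fintype.card α := by
    rw [Finset.sum_comm]
    simp
  have h4 := sq_sum_le_card_mul_sum_sq (s := (Finset.univ : Finset β))
    (f := fun c => ∑ u : α, (if g u = c then (1 : ℝ) else 0))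
  rw [h3, Finset.card_univ] at h4
  rw [h2]
  linarith

lemma sum_dB_bound {α F : Type*} [Fintype α] [Fintype F] [DecidableEq F] (n b : ℕ)
    (p : α → Fin n → F) :
    ((Fintype.card F : ℝ) ^ b) * (∑ u : α, ∑ v : α, (dB F n b (p u) (p v) : ℝ))
      ≤ n * ((Fintype.card α : ℝ) ^ 2 * ((Fintype.card F : ℝ) ^ b - 1)) := by
  have h1 : (∑ u : α, ∑ v : α, (dB F n b (p u) (p v) : ℝ))
      = ∑ i : Fin n, ∑ u : α, ∑ v : α,
        (if piB F n b (p u) i ≠ piB F n b (p v) i then (1 : ℝ) else 0) := by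
    conv_rhs => rw [Finset.sum_comm]
    refine Finset.sum_congr rfl fun u _ => ?_
    conv_rhs => rw [Finset.sum_comm]
    refine Finset.sum_congr rfl fun v _ => ?_
    rw [Finset.sum_boole]
    rfl
  rw [h1, Finset.mul_sum]
  have h2 : ∀ i ∈ (Finset.univ : Finset (Fin n)), (Fintype.card F : ℝ) ^ b *
      (∑ u : α, ∑ v : α, (if piB F n b (p u) i ≠ piB F n b (p v) i then (1 : ℝ) else 0))
      ≤ (Fintype.card α : ℝ) ^ 2 * ((Fintype.card F : ℝ) ^ b - 1) := by
    intro i _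
    have := pairs_ne_bound (fun u : α => piB F n b (p u) i)
    simpa using this
  refine (Finset.sum_le_sum h2).trans ?_
  simp

theorem plotkin_bound_ECC_bsymbol (F : Type*) [Field F] [Fintype F] [DecidableEq F]
    (q k r b t : ℕ) (hq : Fintype.card F = q) (hb : 1 ≤ b) (hbk : b ≤ k) (ht : 1 ≤ t)
    (f : (Fin k → F) →ₗ[F] (Fin k → F)) (hf : Function.Bijective f)
    (p : (Fin k → F) → (Fin r → F))
    (hp : ∀ u v : Fin k → F, u ≠ v →
      (dB F r b (p u) (p v) : ℤ) ≥ max (2 * (t : ℤ) - b + 2 - dB F k b u v) 0) :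
    (k : ℝ) + r ≥ ((q : ℝ) ^ b / ((q : ℝ) ^ b - 1)) * (2 * (t : ℝ) - b + 2) * (1 - ((q : ℝ) ^ k)⁻¹) := by
  subst hq
  have hA := sum_dB_bound (F := F) k b (fun u : Fin k → F => u)
  have hB := sum_dB_bound (F := F) r b p
  have hM : (Fintype.card (Fin k → F) : ℝ) = (Fintype.card F : ℝ) ^ k := by simp
  have hq1 : (1 : ℝ) < Fintype.card F := by exact_mod_cast Fintype.one_lt_card
  have hQ : (1 : ℝ) < (Fintype.card F : ℝ) ^ b := one_lt_pow₀ hq1 (by omega)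
  have hMp : (0 : ℝ) < (Fintype.card F : ℝ) ^ k := by positivity
  have hlow : ∀ u v : Fin k → F, (2 * (t : ℝ) - b + 2) * (1 - if u = v then 1 else 0)
      ≤ (dB F k b u v : ℝ) + dB F r b (p u) (p v) := by
    intro u v
    by_cases h : u = v
    · simp only [h, if_true, sub_self, mul_zero]
      positivity
    · have h1 := (le_max_left _ _).trans (hp u v h)
      have h2 : 2 * (t : ℝ) - b + 2 - dB F k b u v ≤ dB F r b (p u) (p v) := by exact_mod_cast h1
      simp only [h, if_false]
      linarith
  have hsum := Finset.sum_le_sum fun u (_ : u ∈ (Finset.univ : Finset (Fin k → F))) =>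
    Finset.sum_le_sum fun v (_ : v ∈ (Finset.univ : Finset (Fin k → F))) => hlow u v
  simp_rw [Finset.sum_add_distrib, ← Finset.mul_sum, Finset.sum_sub_distrib] at hsum
  simp only [Finset.sum_ite_eq, Finset.mem_univ, if_true, Finset.sum_const, Finset.card_univ,
    nsmul_eq_mul, mul_one, hM] at hsum
  rw [hM] at hA hB
  generalize (Fintype.card F : ℝ) ^ b = Q at *
  generalize (Fintype.card F : ℝ) ^ k = M at *
  generalize 2 * (t : ℝ) - b + 2 = D at *
  have key : Q * (D * (M * M - M)) ≤ (k + r) * (M ^ 2 * (Q - 1)) := by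
    have := mul_le_mul_of_nonneg_left hsum (by linarith : (0 : ℝ) ≤ Q)
    linarith
  have hQ1 : 0 < Q - 1 := by linarith
  have e : Q / (Q - 1) * D * (1 - M⁻¹) = Q * (D * (M * M - M)) / (M ^ 2 * (Q - 1)) := by
    field_simp
  rw [ge_iff_le, e, div_le_iff₀ (by positivity)]
  exact key
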